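/- arXiv:1312.0850 — 2 statements merged into one kernel-verified Lean document; each statement's English description precedes it below -/
import Mathlib

section
/- Complete monotonicity of Z: if M ∈ 𝓜^sh, then for every n ∈ ℕ and all Borel sets A_1, …, A_n, B of finite unit partition number, the iterated difference (Δ({A_i}_{i=1}^n)Z(·, M))(B) = Σ_{I ⊆ [n]} (−1)^{|I|} Z(B ∪ ⋃_{i∈I} A_i, M) is non-negative. -/
open MeasureTheory Metric

/-- Indicator of 1-hard-core tuples: `1` iff all pairs of distinct coordinates are at
distance at least one. (`h_0 = 1` by the empty quantification.) -/
noncomputable def hardCore {X : Type*} [MetricSpace X] (n : ℕ) (x : Fin n → X) : ℝ :=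
  if ∀ i j : Fin n, i ≠ j → 1 ≤ dist (x i) (x j) then 1 else 0

/-- The generating function `Z(B, M)` of weighted 1-hard-core configurations. -/
noncomputable def genZ {X : Type*} [MetricSpace X] [MeasurableSpace X]
    (B : Set X) (M : Measure X) : ℝ :=
  ∑' n : ℕ, ((-1 : ℝ) ^ n / n.factorial) *
    ∫ x in (Set.univ.pi fun _ : Fin n => B), hardCore n x ∂(Measure.pi fun _ : Fin n => M)

/-- The unit partition number `κ(B)`: the least `k` such that `B` is a disjoint union of
`k` Borel sets of diameter less than one (`⊤` if there is no such finite partition). -/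
noncomputable def kappa {X : Type*} [MetricSpace X] [MeasurableSpace X] (B : Set X) : ℕ∞ :=
  sInf {k : ℕ∞ | ∃ m : ℕ, k = (m : ℕ∞) ∧ ∃ A : Fin m → Set X,
    (∀ i, MeasurableSet (A i)) ∧ (∀ i, EMetric.diam (A i) < 1) ∧
    Pairwise (Function.onFun Disjoint A) ∧ B = ⋃ i, A i}

theorem biUnion_diff_union {X ι : Type*} (t : Finset ι) (A : ι → Set X) (B U : Set X) :
    (B ∪ ⋃ i ∈ t, A i) \ U = (B \ U) ∪ ⋃ i ∈ t, A i \ U := by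
  simp only [Set.union_sdiff_distrib, Set.iUnion_sdiff]

/-- The tuples whose `i`-th coordinate is in `A` while all other coordinates are in `B`. -/
def slotSet {X : Type*} {n : ℕ} (i : Fin (n + 1)) (A B : Set X) : Set (Fin (n + 1) → X) :=
  {x | x i ∈ A ∧ ∀ j, x (i.succAbove j) ∈ B}

theorem mem_slotSet {X : Type*} {n : ℕ} {i : Fin (n + 1)} {A B : Set X} {x : Fin (n + 1) → X} :
    x ∈ slotSet i A B ↔ x i ∈ A ∧ ∀ j, x (i.succAbove j) ∈ B :=
  Iff.rfl

theorem slotSet_subset_pi {X : Type*} {n : ℕ} (i : Fin (n + 1)) (A B : Set X) :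
    slotSet i A B ⊆ Set.univ.pi fun _ => B ∪ A := by
  intro x hx
  rw [Set.mem_univ_pi, i.forall_iff_succAbove]
  exact ⟨Or.inr hx.1, fun j => Or.inl (hx.2 j)⟩

theorem measurableSet_slotSet {X : Type*} [MeasurableSpace X] {n : ℕ} (i : Fin (n + 1))
    {A B : Set X} (hA : MeasurableSet A) (hB : MeasurableSet B) :
    MeasurableSet (slotSet i A B) := by
  have : slotSet i A B = (fun x => x i) ⁻¹' A ∩ ⋂ j, (fun x => x (i.succAbove j)) ⁻¹' B := by
    ext x
    simp [mem_slotSet]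
  rw [this]
  exact (measurable_pi_apply i hA).inter
    (.iInter fun j => measurable_pi_apply (i.succAbove j) hB)

section HardCore

variable {X : Type*} [MetricSpace X]

theorem isBounded_of_ediam_lt_one {P : Set X} (hd : ediam P < 1) : Bornology.IsBounded P :=
  isBounded_iff_ediam_ne_top.2 (hd.trans_le le_top).ne

theorem hardCore_nonneg (n : ℕ) (x : Fin n → X) : 0 ≤ hardCore n x := by
  unfold hardCore; split_ifs <;> norm_num

theorem hardCore_le_one (n : ℕ) (x : Fin n → X) : hardCore n x ≤ 1 := by
  unfold hardCore; split_ifs <;> norm_num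

theorem hardCore_insertNth (n : ℕ) (i : Fin (n + 1)) (a : X) (y : Fin n → X) :
    hardCore (n + 1) (i.insertNth a y : Fin (n + 1) → X) =
      if ∀ j, 1 ≤ dist (y j) a then hardCore n y else 0 := by
  unfold hardCore
  have : (∀ k l : Fin (n + 1), k ≠ l →
      1 ≤ dist ((i.insertNth a y : Fin (n + 1) → X) k) ((i.insertNth a y : Fin (n + 1) → X) l)) ↔
      (∀ j, 1 ≤ dist (y j) a) ∧ ∀ k l, k ≠ l → 1 ≤ dist (y k) (y l) := by
    simp only [i.forall_iff_succAbove, Fin.insertNth_apply_same, Fin.insertNth_apply_succAbove,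
      ne_eq, not_true_eq_false, false_imp_iff, true_and, Fin.succAbove_ne, Fin.ne_succAbove,
      not_false_eq_true, true_imp_iff, Fin.succAbove_right_inj]
    constructor
    · rintro ⟨h1, h2⟩
      exact ⟨fun j => (h2 j).1, fun k => (h2 k).2⟩
    · rintro ⟨h1, h2⟩
      exact ⟨fun j => by rw [dist_comm]; exact h1 j, fun k => ⟨h1 k, h2 k⟩⟩
  simp only [this]
  split_ifs <;> tauto

/-- A hard-core configuration in `B ∪ A` with `A` of diameter less than one has at most one
point in `A`. -/
theorem indicator_hardCore_union (n : ℕ) {A B : Set X} (hA : ediam A < 1) (hAB : Disjoint A B)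
    (x : Fin (n + 1) → X) :
    (Set.univ.pi fun _ : Fin (n + 1) => B ∪ A).indicator (hardCore (n + 1)) x =
      (Set.univ.pi fun _ : Fin (n + 1) => B).indicator (hardCore (n + 1)) x +
      ∑ i, (slotSet i A B).indicator
        (hardCore (n + 1)) x := by
  classical
  simp only [Set.indicator_apply, Set.mem_univ_pi, mem_slotSet]
  by_cases hh : ∀ i j : Fin (n + 1), i ≠ j → 1 ≤ dist (x i) (x j)
  swap
  · simp [hardCore, hh]
  have hA1 : ∀ i j, x i ∈ A → x j ∈ A → i = j := by
    intro i j hi hj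
    by_contra hij
    have h1 := (edist_le_ediam_of_mem hi hj).trans_lt hA
    rw [edist_dist, ← ENNReal.ofReal_one, ENNReal.ofReal_lt_ofReal_iff one_pos] at h1
    exact absurd (hh i j hij) (not_le.2 h1)
  have hdis : ∀ {z}, z ∈ A → z ∉ B := fun hz hz' => Set.disjoint_left.1 hAB hz hz'
  by_cases hex : ∃ k, x k ∈ A
  · obtain ⟨k, hk⟩ := hex
    have hB : ¬ ∀ i, x i ∈ B := fun h => hdis hk (h k)
    rw [Finset.sum_eq_single k, if_neg hB, zero_add]
    · congr 1
      rw [k.forall_iff_succAbove]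
      refine propext ⟨fun h => ⟨hk, fun j => (h.2 j).resolve_right fun hj => ?_⟩,
        fun h => ⟨Or.inr hk, fun j => Or.inl (h.2 j)⟩⟩
      exact k.succAbove_ne j (hA1 _ _ hj hk)
    · intro i _ hik
      exact if_neg fun h => hik (hA1 _ _ h.1 hk)
    · simp
  · push Not at hex
    simp [hex]

end HardCore

section Integrals

variable {X : Type*} [MetricSpace X] [MeasurableSpace X]

/-- The integral of the hard-core indicator over `B ^ n`. -/
noncomputable def hardCoreIntegral (M : Measure X) (n : ℕ) (B : Set X) : ℝ :=
  ∫ x in (Set.univ.pi fun _ : Fin n => B), hardCore n x ∂(Measure.pi fun _ : Fin n => M)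

theorem genZ_eq_tsum (M : Measure X) (B : Set X) :
    genZ B M = ∑' n : ℕ, ((-1 : ℝ) ^ n / n.factorial) * hardCoreIntegral M n B := rfl

theorem hardCoreIntegral_nonneg (M : Measure X) (n : ℕ) (B : Set X) :
    0 ≤ hardCoreIntegral M n B :=
  integral_nonneg fun x => hardCore_nonneg n x

theorem hardCoreIntegral_zero (M : Measure X) [SigmaFinite M] (B : Set X) :
    hardCoreIntegral M 0 B = 1 := by
  simp [hardCoreIntegral, hardCore, measureReal_def]

theorem hardCoreIntegral_le (M : Measure X) [SigmaFinite M] (n : ℕ) {B : Set X}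
    (hB : M B < ⊤) : hardCoreIntegral M n B ≤ M.real B ^ n := by
  have hfin : (Measure.pi fun _ : Fin n => M) (Set.univ.pi fun _ : Fin n => B) < ⊤ := by
    simpa [Measure.pi_pi] using ENNReal.pow_lt_top hB
  refine (Real.le_norm_self _).trans
    ((norm_setIntegral_le_of_norm_le_const (f := hardCore n) (C := 1) hfin ?_).trans ?_)
  · intro x _
    rw [Real.norm_of_nonneg (hardCore_nonneg n x)]
    exact hardCore_le_one n x
  · simp [measureReal_def, Measure.pi_pi]

theorem norm_genZ_term_le (M : Measure X) [SigmaFinite M] {B S : Set X} (hBS : B ⊆ S)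
    (hS : M S < ⊤) (n : ℕ) :
    ‖((-1 : ℝ) ^ n / n.factorial) * hardCoreIntegral M n B‖ ≤ M.real S ^ n / n.factorial := by
  have h1 : hardCoreIntegral M n B ≤ M.real S ^ n :=
    (hardCoreIntegral_le M n ((measure_mono hBS).trans_lt hS)).trans
      (pow_le_pow_left₀ measureReal_nonneg (measureReal_mono hBS hS.ne) n)
  rw [norm_mul, norm_div, norm_pow, norm_neg, norm_one, one_pow,
    Real.norm_of_nonneg (hardCoreIntegral_nonneg M n B), Real.norm_of_nonneg (by positivity),
    one_div, inv_mul_eq_div]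
  gcongr

theorem summable_genZ (M : Measure X) [SigmaFinite M] {B : Set X} (hB : M B < ⊤) :
    Summable fun n : ℕ => ((-1 : ℝ) ^ n / n.factorial) * hardCoreIntegral M n B :=
  .of_norm_bounded (Real.summable_pow_div_factorial (M.real B))
    (norm_genZ_term_le M subset_rfl hB)

variable [TopologicalSpace.SeparableSpace X] [BorelSpace X]

theorem measurable_hardCore (n : ℕ) : Measurable (hardCore n : (Fin n → X) → ℝ) := by
  have := UniformSpace.secondCountable_of_separable X
  refine Measurable.ite ?_ measurable_const measurable_const
  simp only [Set.ofPred_forall]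
  refine .iInter fun i => .iInter fun j => .iInter fun _ => ?_
  exact measurableSet_le measurable_const ((measurable_pi_apply i).dist (measurable_pi_apply j))

theorem integrable_indicator_hardCore (M : Measure X) [SigmaFinite M] (n : ℕ) {B : Set X}
    (hB : M B < ⊤) {S : Set (Fin n → X)} (hS : MeasurableSet S)
    (hSB : S ⊆ Set.univ.pi fun _ => B) :
    Integrable (S.indicator (hardCore n)) (Measure.pi fun _ : Fin n => M) := by
  rw [integrable_indicator_iff hS]
  refine IntegrableOn.of_bound ((measure_mono hSB).trans_lt ?_)
    (measurable_hardCore n).aestronglyMeasurable 1 (.of_forall fun x => ?_)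
  · simpa [Measure.pi_pi] using ENNReal.pow_lt_top hB
  · rw [Real.norm_of_nonneg (hardCore_nonneg n x)]
    exact hardCore_le_one n x

theorem measurable_hardCoreIntegral_diff_ball (M : Measure X) [SigmaFinite M] (n : ℕ)
    {B : Set X} (hB : MeasurableSet B) :
    Measurable fun a => hardCoreIntegral M n (B \ ball a 1) := by
  have := UniformSpace.secondCountable_of_separable X
  let S : Set (X × (Fin n → X)) := {p | ∀ j, p.2 j ∈ B ∧ 1 ≤ dist (p.2 j) p.1}
  have hS : MeasurableSet S := by
    have hj (j : Fin n) : Measurable fun p : X × (Fin n → X) => p.2 j := by fun_prop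
    simp only [S, Set.ofPred_forall]
    exact .iInter fun j => .inter (hj j hB)
      (measurableSet_le measurable_const ((hj j).dist measurable_fst))
  have hm : StronglyMeasurable (S.indicator fun p => hardCore n p.2) :=
    (((measurable_hardCore n).comp measurable_snd).indicator hS).stronglyMeasurable
  have hI : StronglyMeasurable fun a => ∫ y, S.indicator (fun p => hardCore n p.2) (a, y)
      ∂(Measure.pi fun _ : Fin n => M) := hm.integral_prod_right'
  convert hI.measurable using 2 with a
  rw [hardCoreIntegral, ← integral_indicator
    (MeasurableSet.univ_pi fun _ => hB.diff measurableSet_ball)]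
  congr 1 with y
  have : y ∈ (Set.univ.pi fun _ : Fin n => B \ ball a 1) ↔ (a, y) ∈ S := by
    simp [S]
  by_cases hy : (a, y) ∈ S
  · rw [Set.indicator_of_mem hy, Set.indicator_of_mem (this.2 hy)]
  · rw [Set.indicator_of_notMem hy, Set.indicator_of_notMem (mt this.1 hy)]

theorem integral_indicator_insertNth (M : Measure X) [SigmaFinite M] (n : ℕ) {A B : Set X}
    (hA : MeasurableSet A) (hB : MeasurableSet B) (hAf : M A < ⊤) (hBf : M B < ⊤)
    (i : Fin (n + 1)) :
    ∫ x, (slotSet i A B).indicator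
        (hardCore (n + 1)) x ∂(Measure.pi fun _ : Fin (n + 1) => M) =
      ∫ a in A, hardCoreIntegral M n (B \ ball a 1) ∂M := by
  classical
  have hmp := (measurePreserving_piFinSuccAbove (fun _ : Fin (n + 1) => M) i).symm
  have hint := integrable_indicator_hardCore M (n + 1) (B := B ∪ A)
    ((measure_union_le B A).trans_lt (ENNReal.add_lt_top.2 ⟨hBf, hAf⟩)) (measurableSet_slotSet i hA hB)
    (slotSet_subset_pi i A B)
  rw [← hmp.integral_comp', integral_prod (fun p => (slotSet i A B).indicator (hardCore (n + 1))
      ((MeasurableEquiv.piFinSuccAbove (fun _ => X) i).symm p))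
    ((hmp.integrable_comp_emb (MeasurableEquiv.measurableEmbedding _)).2 hint),
    ← integral_indicator hA]
  refine integral_congr_ae (.of_forall fun a => ?_)
  by_cases ha : a ∈ A
  · rw [Set.indicator_of_mem ha]
    simp only [hardCoreIntegral]
    rw [← integral_indicator (MeasurableSet.univ_pi fun _ => hB.diff measurableSet_ball)]
    refine integral_congr_ae (.of_forall fun y => ?_)
    have : (MeasurableEquiv.piFinSuccAbove (fun _ => X) i).symm (a, y) = i.insertNth a y := rfl
    simp only [this, Set.indicator_apply, mem_slotSet, Fin.insertNth_apply_same,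
      Fin.insertNth_apply_succAbove, hardCore_insertNth, Set.mem_univ_pi, Set.mem_sdiff, mem_ball,
      not_lt, ha, true_and, forall_and]
    split_ifs <;> tauto
  · rw [Set.indicator_of_notMem ha]
    refine integral_eq_zero_of_ae (.of_forall fun y => ?_)
    have : (MeasurableEquiv.piFinSuccAbove (fun _ => X) i).symm (a, y) = i.insertNth a y := rfl
    simp [this, mem_slotSet, ha]

theorem hardCoreIntegral_union (M : Measure X) [SigmaFinite M] (n : ℕ) {A B : Set X}
    (hA : MeasurableSet A) (hB : MeasurableSet B) (hAf : M A < ⊤) (hBf : M B < ⊤)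
    (hd : ediam A < 1) (hAB : Disjoint A B) :
    hardCoreIntegral M (n + 1) (B ∪ A) = hardCoreIntegral M (n + 1) B +
      (n + 1) * ∫ a in A, hardCoreIntegral M n (B \ ball a 1) ∂M := by
  have hU : M (B ∪ A) < ⊤ :=
    (measure_union_le B A).trans_lt (ENNReal.add_lt_top.2 ⟨hBf, hAf⟩)
  have hslot := fun i => integrable_indicator_hardCore M (n + 1) hU
    (measurableSet_slotSet i hA hB) (slotSet_subset_pi i A B)
  rw [hardCoreIntegral, ← integral_indicator (MeasurableSet.univ_pi fun _ => hB.union hA)]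
  simp only [indicator_hardCore_union n hd hAB]
  rw [integral_add, integral_finsetSum]
  · simp only [integral_indicator_insertNth M n hA hB hAf hBf]
    rw [integral_indicator (MeasurableSet.univ_pi fun _ => hB)]
    simp [hardCoreIntegral]
  · exact fun i _ => hslot i
  · exact integrable_indicator_hardCore M (n + 1) hBf (MeasurableSet.univ_pi fun _ => hB)
      subset_rfl
  · exact integrable_finsetSum _ fun i _ => hslot i

theorem integrableOn_genZ_diff_ball (M : Measure X) [SigmaFinite M] {A B : Set X}
    (hB : MeasurableSet B) (hAf : M A < ⊤) (hBf : M B < ⊤) :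
    IntegrableOn (fun a => genZ (B \ ball a 1) M) A M := by
  have hs : ∀ a, Summable fun n : ℕ =>
      ((-1 : ℝ) ^ n / n.factorial) * hardCoreIntegral M n (B \ ball a 1) := fun a =>
    summable_genZ M ((measure_mono Set.sdiff_subset).trans_lt hBf)
  have hm : Measurable fun a => genZ (B \ ball a 1) M := by
    refine measurable_of_tendsto_metrizable (f := fun (N : ℕ) a => ∑ n ∈ Finset.range N,
      ((-1 : ℝ) ^ n / n.factorial) * hardCoreIntegral M n (B \ ball a 1)) (fun N => ?_)
      (tendsto_pi_nhds.2 fun a => (hs a).hasSum.tendsto_sum_nat)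
    exact Finset.measurable_fun_sum _ fun n _ =>
      (measurable_hardCoreIntegral_diff_ball M n hB).const_mul _
  refine IntegrableOn.of_bound hAf hm.aestronglyMeasurable
    (∑' n : ℕ, M.real B ^ n / n.factorial) (.of_forall fun a => ?_)
  exact tsum_of_norm_bounded (Real.summable_pow_div_factorial (M.real B)).hasSum
    (norm_genZ_term_le M Set.sdiff_subset hBf)

theorem genZ_sub_genZ_union_of_disjoint (M : Measure X) [SigmaFinite M] {A B : Set X}
    (hA : MeasurableSet A) (hB : MeasurableSet B) (hAf : M A < ⊤) (hBf : M B < ⊤)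
    (hd : ediam A < 1) (hAB : Disjoint A B) :
    genZ B M - genZ (B ∪ A) M = ∫ a in A, genZ (B \ ball a 1) M ∂M := by
  have hU : M (B ∪ A) < ⊤ :=
    (measure_union_le B A).trans_lt (ENNReal.add_lt_top.2 ⟨hBf, hAf⟩)
  have hfin : IsFiniteMeasure (M.restrict A) := isFiniteMeasure_restrict.2 hAf.ne
  have key := hasSum_integral_of_dominated_convergence (μ := M.restrict A)
    (F := fun (n : ℕ) a => ((-1 : ℝ) ^ n / n.factorial) * hardCoreIntegral M n (B \ ball a 1))
    (f := fun a => genZ (B \ ball a 1) M) (fun n _ => M.real B ^ n / n.factorial)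
    (fun n => ((measurable_hardCoreIntegral_diff_ball M n hB).const_mul _).aestronglyMeasurable)
    (fun n => .of_forall fun a => norm_genZ_term_le M Set.sdiff_subset hBf n)
    (.of_forall fun a => Real.summable_pow_div_factorial (M.real B))
    (integrable_const _)
    (.of_forall fun a =>
      (summable_genZ M ((measure_mono Set.sdiff_subset).trans_lt hBf)).hasSum)
  rw [← key.tsum_eq, genZ_eq_tsum, genZ_eq_tsum, (summable_genZ M hBf).tsum_eq_zero_add,
    (summable_genZ M hU).tsum_eq_zero_add, hardCoreIntegral_zero, hardCoreIntegral_zero,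
    add_sub_add_left_eq_sub, ← ((summable_nat_add_iff 1).2 (summable_genZ M hBf)).tsum_sub
      ((summable_nat_add_iff 1).2 (summable_genZ M hU))]
  refine tsum_congr fun n => ?_
  rw [hardCoreIntegral_union M n hA hB hAf hBf hd hAB, integral_const_mul, Nat.factorial_succ]
  push_cast
  field_simp
  ring

theorem genZ_sub_genZ_union (M : Measure X) [SigmaFinite M] {A B : Set X}
    (hA : MeasurableSet A) (hB : MeasurableSet B) (hAf : M A < ⊤) (hBf : M B < ⊤)
    (hd : ediam A < 1) :
    genZ B M - genZ (B ∪ A) M = ∫ a, (A \ B).indicator (fun a => genZ (B \ ball a 1) M) a ∂M := by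
  rw [← Set.union_sdiff_self, genZ_sub_genZ_union_of_disjoint M (hA.diff hB) hB
    ((measure_mono Set.sdiff_subset).trans_lt hAf) hBf ((ediam_mono Set.sdiff_subset).trans_lt hd)
    Set.disjoint_sdiff_left, integral_indicator (hA.diff hB)]

end Integrals

section Monotonicity

variable {X : Type*} [MetricSpace X] [MeasurableSpace X]

/-- Finite unions of measurable sets of diameter less than one. -/
inductive IsFiniteUnionSmall : Set X → Prop
  | empty : IsFiniteUnionSmall ∅
  | union {C P : Set X} (hC : IsFiniteUnionSmall C) (hP : MeasurableSet P) (hd : ediam P < 1) :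
      IsFiniteUnionSmall (C ∪ P)

namespace IsFiniteUnionSmall

theorem measurableSet {C : Set X} (hC : IsFiniteUnionSmall C) : MeasurableSet C := by
  induction hC with
  | empty => exact .empty
  | union _ hP _ ih => exact ih.union hP

theorem isBounded {C : Set X} (hC : IsFiniteUnionSmall C) : Bornology.IsBounded C := by
  induction hC with
  | empty => exact Bornology.isBounded_empty
  | union _ _ hd ih => exact ih.union (isBounded_of_ediam_lt_one hd)

theorem diff {C S : Set X} (hC : IsFiniteUnionSmall C) (hS : MeasurableSet S) :
    IsFiniteUnionSmall (C \ S) := by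
  induction hC with
  | empty => simpa using empty
  | union _ hP hd ih =>
    rw [Set.union_sdiff_distrib]
    exact ih.union (hP.diff hS) ((ediam_mono Set.sdiff_subset).trans_lt hd)

theorem of_kappa_lt_top {C : Set X} (h : kappa C < ⊤) : IsFiniteUnionSmall C := by
  obtain ⟨_, ⟨m, -, P, hP, hd, -, rfl⟩, -⟩ := sInf_lt_iff.1 h
  clear h
  induction m with
  | zero => simpa using empty
  | succ m ih =>
    have hU : ⋃ i, P i = (⋃ i : Fin m, P i.castSucc) ∪ P (Fin.last m) := by
      ext x
      simp [Fin.exists_fin_succ']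
    rw [hU]
    exact (ih _ (fun i => hP _) fun i => hd _).union (hP _) (hd _)

end IsFiniteUnionSmall

theorem measurableSet_isBounded_union_biUnion {ι : Type*} {A : ι → Set X}
    (hA : ∀ i, IsFiniteUnionSmall (A i)) {B : Set X} (hB : MeasurableSet B)
    (hBb : Bornology.IsBounded B) (t : Finset ι) :
    MeasurableSet (B ∪ ⋃ i ∈ t, A i) ∧ Bornology.IsBounded (B ∪ ⋃ i ∈ t, A i) :=
  ⟨hB.union (t.measurableSet_biUnion fun i _ => (hA i).measurableSet),
    hBb.union ((Bornology.isBounded_biUnion_finset t).2 fun i _ => (hA i).isBounded)⟩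

/-- For a fixed point `a`, the alternating sum of the integrands of the first differences is an
alternating sum over the sets that do not contain `a`. -/
theorem sum_powerset_indicator_genZ {ι : Type*} (M : Measure X) (s : Finset ι)
    (A : ι → Set X) (P B : Set X) (a : X) [DecidablePred fun i => a ∉ A i] :
    ∑ t ∈ s.powerset, (-1 : ℝ) ^ t.card * (P \ (B ∪ ⋃ i ∈ t, A i)).indicator
        (fun a => genZ ((B ∪ ⋃ i ∈ t, A i) \ ball a 1) M) a =
      (P \ B).indicator (fun _ => ∑ t ∈ (s.filter fun i => a ∉ A i).powerset,
        (-1 : ℝ) ^ t.card * genZ ((B \ ball a 1) ∪ ⋃ i ∈ t, A i \ ball a 1) M) a := by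
  classical
  by_cases ha : a ∈ P \ B
  · rw [Set.indicator_of_mem ha, ← Finset.sum_subset
      (Finset.powerset_mono.2 (s.filter_subset fun i => a ∉ A i))]
    · refine Finset.sum_congr rfl fun t ht => ?_
      have hmem : a ∈ P \ (B ∪ ⋃ i ∈ t, A i) := by
        refine ⟨ha.1, ?_⟩
        simp only [Set.mem_union, Set.mem_iUnion, not_or, not_exists]
        exact ⟨ha.2, fun i hi => (Finset.mem_filter.1 (Finset.mem_powerset.1 ht hi)).2⟩
      rw [Set.indicator_of_mem hmem, biUnion_diff_union]
    · intro t ht hts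
      have hnot : a ∉ P \ (B ∪ ⋃ i ∈ t, A i) := by
        refine fun h => hts (Finset.mem_powerset.2 fun i hi => Finset.mem_filter.2
          ⟨Finset.mem_powerset.1 ht hi, fun hai => h.2 (Or.inr ?_)⟩)
        exact Set.mem_biUnion hi hai
      rw [Set.indicator_of_notMem hnot, mul_zero]
  · rw [Set.indicator_of_notMem ha]
    refine Finset.sum_eq_zero fun t _ => ?_
    rw [Set.indicator_of_notMem, mul_zero]
    exact fun h => ha ⟨h.1, fun hB => h.2 (Or.inl hB)⟩

theorem sum_powerset_genZ_nonneg [TopologicalSpace.SeparableSpace X] [BorelSpace X]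
    (M : Measure X) [SigmaFinite M]
    (hM : ∀ s : Set X, Bornology.IsBounded s → M s < ⊤)
    (hsh : ∀ B : Set X, MeasurableSet B → Bornology.IsBounded B → 0 ≤ genZ B M)
    {ι : Type*} (s : Finset ι) (A : ι → Set X) (hA : ∀ i, IsFiniteUnionSmall (A i))
    (B : Set X) (hB : MeasurableSet B) (hBb : Bornology.IsBounded B) :
    0 ≤ ∑ t ∈ s.powerset, (-1 : ℝ) ^ t.card * genZ (B ∪ ⋃ i ∈ t, A i) M := by
  classical
  induction s using Finset.strongInduction generalizing A B with
  | H s ih =>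
  obtain rfl | ⟨k, hk⟩ := s.eq_empty_or_nonempty
  · simpa using hsh B hB hBb
  obtain ⟨r, hkr, rfl⟩ : ∃ r, k ∉ r ∧ insert k r = s :=
    ⟨s.erase k, Finset.notMem_erase k s, Finset.insert_erase hk⟩
  have step : ∀ C : Set X, IsFiniteUnionSmall C →
      0 ≤ ∑ t ∈ r.powerset, (-1 : ℝ) ^ t.card *
        (genZ (B ∪ ⋃ i ∈ t, A i) M - genZ ((B ∪ C) ∪ ⋃ i ∈ t, A i) M) := by
    intro C hC
    induction hC with
    | empty => simp
    | @union C P hC hP hd ihC =>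
      have hB' : MeasurableSet (B ∪ C) := hB.union hC.measurableSet
      have hBb' : Bornology.IsBounded (B ∪ C) := hBb.union hC.isBounded
      have hPf := hM P (isBounded_of_ediam_lt_one hd)
      have hmb := measurableSet_isBounded_union_biUnion hA hB' hBb'
      have hsmall : 0 ≤ ∑ t ∈ r.powerset, (-1 : ℝ) ^ t.card *
          (genZ ((B ∪ C) ∪ ⋃ i ∈ t, A i) M - genZ (((B ∪ C) ∪ ⋃ i ∈ t, A i) ∪ P) M) := by
        simp only [fun t => genZ_sub_genZ_union M hP (hmb t).1 hPf (hM _ (hmb t).2) hd,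
          ← integral_const_mul]
        rw [← integral_finsetSum]
        · refine integral_nonneg fun a => ?_
          simp only [sum_powerset_indicator_genZ, Pi.zero_apply]
          refine Set.indicator_apply_nonneg fun _ => ?_
          exact ih _ ((Finset.filter_subset _ _).trans_ssubset (Finset.ssubset_insert hkr)) _
            (fun i => (hA i).diff measurableSet_ball) _ (hB'.diff measurableSet_ball)
            (hBb'.subset Set.sdiff_subset)
        · intro t _
          refine Integrable.const_mul ?_ _
          rw [integrable_indicator_iff (hP.diff (hmb t).1)]
          exact integrableOn_genZ_diff_ball M (hmb t).1
            ((measure_mono Set.sdiff_subset).trans_lt hPf) (hM _ (hmb t).2)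
      refine (add_nonneg ihC hsmall).trans_eq ?_
      rw [← Finset.sum_add_distrib]
      refine Finset.sum_congr rfl fun t _ => ?_
      rw [Set.union_right_comm (B ∪ C) _ P, ← Set.union_assoc B C P]
      ring
  refine (step (A k) (hA k)).trans_eq ?_
  rw [Finset.sum_powerset_insert hkr, ← Finset.sum_add_distrib]
  refine Finset.sum_congr rfl fun t ht => ?_
  rw [Finset.card_insert_of_notMem fun h => hkr (Finset.mem_powerset.1 ht h),
    Finset.set_biUnion_insert, Set.union_assoc B (A k)]
  ring

end Monotonicity

/-- Complete monotonicity of `Z`: if `M ∈ 𝓜^sh`, then for all Borel sets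
`A_1, …, A_n, B` of finite unit partition number, the iterated difference
`Σ_{I ⊆ [n]} (−1)^{|I|} Z(B ∪ ⋃_{i ∈ I} A_i, M)` is non-negative. -/
theorem stmt8 {X : Type*} [MetricSpace X] [CompleteSpace X]
    [TopologicalSpace.SeparableSpace X] [MeasurableSpace X] [BorelSpace X]
    (M : Measure X) (hM : ∀ s : Set X, Bornology.IsBounded s → M s < ⊤)
    (hsh : ∀ B : Set X, MeasurableSet B → Bornology.IsBounded B → 0 ≤ genZ B M)
    (n : ℕ) (A : Fin n → Set X) (B : Set X)
    (hAm : ∀ i, MeasurableSet (A i)) (hAk : ∀ i, kappa (A i) < ⊤)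
    (hBm : MeasurableSet B) (hBk : kappa B < ⊤) :
    0 ≤ ∑ I : Finset (Fin n), (-1 : ℝ) ^ I.card * genZ (B ∪ ⋃ i ∈ I, A i) M := by
  have : IsLocallyFiniteMeasure M :=
    ⟨fun x => ⟨ball x 1, ball_mem_nhds x one_pos, hM _ isBounded_ball⟩⟩
  have := UniformSpace.secondCountable_of_separable X
  rw [← Finset.powerset_univ]
  exact sum_powerset_genZ_nonneg M hM hsh Finset.univ A
    (fun i => .of_kappa_lt_top (hAk i)) B hBm (IsFiniteUnionSmall.of_kappa_lt_top hBk).isBounded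
end

section
/- Let M be a boundedly finite Borel measure and let A_1, …, A_n, B be pairwise disjoint Borel sets of finite unit partition number. If κ(B ⊔ ⨆_{i=1}^n A_i) < n, then the iterated difference (Δ({A_i}_{i=1}^n)Z(·, M))(B) = Σ_{I ⊆ [n]} (−1)^{|I|} Z(B ⊔ ⨆_{i∈I} A_i, M) equals 0. -/
open MeasureTheory Metric

theorem measurable_hardCore_s9 {X : Type*} [MetricSpace X] [TopologicalSpace.SeparableSpace X]
    [MeasurableSpace X] [BorelSpace X] (n : ℕ) : Measurable (hardCore (X := X) n) := by
  have : SecondCountableTopology X := UniformSpace.secondCountable_of_separable X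
  refine Measurable.ite ?_ measurable_const measurable_const
  simp only [Set.ofPred_forall]
  refine MeasurableSet.iInter fun i => MeasurableSet.iInter fun j => MeasurableSet.iInter fun _ => ?_
  exact measurableSet_le measurable_const ((measurable_pi_apply i).dist (measurable_pi_apply j))

theorem norm_hardCore_le_one {X : Type*} [MetricSpace X] (n : ℕ) (x : Fin n → X) :
    ‖hardCore n x‖ ≤ 1 := by
  unfold hardCore
  split_ifs <;> simp

/-- A hard-core configuration has at most one point in each set of diameter less than one. -/
theorem hardCore_eq_zero_of_lt {X : Type*} [MetricSpace X] {k m : ℕ} (hkm : k < m)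
    {P : Fin k → Set X} (hP : ∀ i, ediam (P i) < 1) {x : Fin m → X}
    (hx : ∀ i, x i ∈ ⋃ l, P l) : hardCore m x = 0 := by
  simp only [Set.mem_iUnion] at hx
  choose f hf using hx
  obtain ⟨i, j, hij, hfij⟩ := Fintype.exists_ne_map_eq_of_card_lt f (by simpa using hkm)
  refine if_neg fun h => (h i j hij).not_gt ?_
  have hd : edist (x i) (x j) < 1 :=
    (edist_le_ediam_of_mem (hf i) (hfij ▸ hf j)).trans_lt (hP (f i))
  rw [edist_dist, ENNReal.ofReal_lt_one] at hd
  exact hd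

/-- Signed sums over subsets cancel when the summand does not depend on some element. -/
theorem sum_neg_one_pow_card_mul_eq_zero {ι : Type*} [Fintype ι] [DecidableEq ι]
    (g : Finset ι → ℝ) (i : ι) (hg : ∀ I, i ∉ I → g (insert i I) = g I) :
    ∑ I : Finset ι, (-1 : ℝ) ^ I.card * g I = 0 := by
  rw [← Finset.powerset_univ, ← Finset.insert_erase (Finset.mem_univ i),
    Finset.sum_powerset_insert (Finset.notMem_erase i _), ← Finset.sum_add_distrib]
  refine Finset.sum_eq_zero fun I hI => ?_
  have hi : i ∉ I := fun h => Finset.notMem_erase i _ (Finset.mem_powerset.1 hI h)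
  rw [hg I hi, Finset.card_insert_of_notMem hi, pow_succ]
  ring

/-- Fewer than `n` points miss one of `n` pairwise disjoint sets. -/
theorem exists_forall_notMem_of_lt {X : Type*} {m n : ℕ} (hmn : m < n) {A : Fin n → Set X}
    (hA : Pairwise (Function.onFun Disjoint A)) (x : Fin m → X) : ∃ i, ∀ j, x j ∉ A i := by
  by_contra! h
  choose f hf using h
  obtain ⟨i, j, hij, hfij⟩ := Fintype.exists_ne_map_eq_of_card_lt f (by simpa using hmn)
  exact Set.disjoint_left.1 (hA hij) (hf i) (hfij ▸ hf j)

theorem sum_neg_one_pow_card_mul_indicator_eq_zero {X : Type*} {m n : ℕ} (hmn : m < n)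
    {A : Fin n → Set X} (hA : Pairwise (Function.onFun Disjoint A)) (B : Set X)
    (f : (Fin m → X) → ℝ) (x : Fin m → X) :
    ∑ I : Finset (Fin n), (-1 : ℝ) ^ I.card *
      (Set.univ.pi fun _ : Fin m => B ∪ ⋃ i ∈ I, A i).indicator f x = 0 := by
  classical
  obtain ⟨i, hi⟩ := exists_forall_notMem_of_lt hmn hA x
  refine sum_neg_one_pow_card_mul_eq_zero _ i fun I _ => ?_
  simp [Set.indicator_apply, hi]

theorem sigmaFinite_of_isBounded_lt_top {X : Type*} [MetricSpace X]
    [TopologicalSpace.SeparableSpace X] [MeasurableSpace X] [BorelSpace X]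
    {M : Measure X} (hM : ∀ s : Set X, Bornology.IsBounded s → M s < ⊤) : SigmaFinite M := by
  have : SecondCountableTopology X := UniformSpace.secondCountable_of_separable X
  have : IsLocallyFiniteMeasure M :=
    ⟨fun x => ⟨ball x 1, ball_mem_nhds x one_pos, hM _ isBounded_ball⟩⟩
  infer_instance

theorem integrableOn_hardCore {X : Type*} [MetricSpace X] [TopologicalSpace.SeparableSpace X]
    [MeasurableSpace X] [BorelSpace X] {M : Measure X} [SigmaFinite M] {C : Set X}
    (hC : M C < ⊤) (m : ℕ) :
    IntegrableOn (hardCore m) (Set.univ.pi fun _ : Fin m => C) (Measure.pi fun _ => M) := by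
  refine Measure.integrableOn_of_bounded (M := 1) ?_
    (measurable_hardCore_s9 m).aestronglyMeasurable (ae_of_all _ (norm_hardCore_le_one m))
  rw [Measure.pi_pi]
  exact (ENNReal.prod_lt_top fun _ _ => hC).ne

/-- If `A_1, …, A_n, B` are pairwise disjoint Borel sets of finite unit partition number
and `κ(B ⊔ ⨆_i A_i) < n`, then `Σ_{I ⊆ [n]} (−1)^{|I|} Z(B ⊔ ⨆_{i ∈ I} A_i, M) = 0`. -/
theorem stmt9 {X : Type*} [MetricSpace X] [CompleteSpace X]
    [TopologicalSpace.SeparableSpace X] [MeasurableSpace X] [BorelSpace X]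
    (M : Measure X) (hM : ∀ s : Set X, Bornology.IsBounded s → M s < ⊤)
    (n : ℕ) (A : Fin n → Set X) (B : Set X)
    (hAm : ∀ i, MeasurableSet (A i)) (hAk : ∀ i, kappa (A i) < ⊤)
    (hBm : MeasurableSet B) (hBk : kappa B < ⊤)
    (hAdisj : Pairwise (Function.onFun Disjoint A))
    (hBdisj : ∀ i, Disjoint B (A i))
    (hk : kappa (B ∪ ⋃ i, A i) < (n : ℕ∞)) :
    ∑ I : Finset (Fin n), (-1 : ℝ) ^ I.card * genZ (B ∪ ⋃ i ∈ I, A i) M = 0 := by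
  classical
  have hσ := sigmaFinite_of_isBounded_lt_top hM
  obtain ⟨_, ⟨k, rfl, P, -, hPd, -, hP⟩, hkn⟩ := sInf_lt_iff.1 hk
  rw [Nat.cast_lt] at hkn
  have hsub : ∀ I : Finset (Fin n), B ∪ ⋃ i ∈ I, A i ⊆ ⋃ l, P l := fun I =>
    hP ▸ Set.union_subset_union_right B (Set.iUnion₂_subset fun i _ => Set.subset_iUnion A i)
  have hfin : ∀ I : Finset (Fin n), M (B ∪ ⋃ i ∈ I, A i) < ⊤ := fun I =>
    hM _ (((Bornology.isBounded_iUnion).2 fun l =>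
      isBounded_iff_ediam_ne_top.2 ((hPd l).trans ENNReal.one_lt_top).ne).subset (hsub I))
  have hmeas : ∀ (I : Finset (Fin n)) (m : ℕ),
      MeasurableSet (Set.univ.pi fun _ : Fin m => B ∪ ⋃ i ∈ I, A i) := fun I m =>
    MeasurableSet.univ_pi fun _ => hBm.union (I.measurableSet_biUnion fun i _ => hAm i)
  have hZ : ∀ I : Finset (Fin n), genZ (B ∪ ⋃ i ∈ I, A i) M =
      ∑ m ∈ Finset.range n, ((-1 : ℝ) ^ m / m.factorial) *
        ∫ x in (Set.univ.pi fun _ : Fin m => B ∪ ⋃ i ∈ I, A i), hardCore m x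
          ∂(Measure.pi fun _ : Fin m => M) := fun I =>
    tsum_eq_sum fun m hm => by
      rw [Finset.mem_range, not_lt] at hm
      have h0 : ∀ x ∈ Set.univ.pi fun _ : Fin m => B ∪ ⋃ i ∈ I, A i, hardCore m x = 0 :=
        fun x hx => hardCore_eq_zero_of_lt (hkn.trans_le hm) hPd fun i => hsub I (hx i trivial)
      rw [setIntegral_eq_zero_of_forall_eq_zero h0, mul_zero]
  simp_rw [hZ, Finset.mul_sum]
  rw [Finset.sum_comm]
  refine Finset.sum_eq_zero fun m hm => ?_
  simp_rw [mul_left_comm _ ((-1 : ℝ) ^ m / m.factorial)]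
  rw [← Finset.mul_sum]
  simp_rw [← integral_indicator (hmeas _ m), ← integral_const_mul]
  rw [← integral_finsetSum _ fun I _ => ((integrable_indicator_iff (hmeas I m)).2
    (integrableOn_hardCore (hfin I) m)).const_mul _]
  simp_rw [sum_neg_one_pow_card_mul_indicator_eq_zero (Finset.mem_range.1 hm) hAdisj B]
  simp
end
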